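/- With the Fourier transform normalized as (𝓕 f)(ξ) = ∫_{-∞}^{∞} f(x) e^{-2πi x ξ} dx, the Fourier transform of the real hyperbolic secant function x ↦ sech x (viewed as a complex-valued function) is ξ ↦ π sech(π² ξ). -/

import Mathlib

open Real MeasureTheory FourierTransform

lemma sigmoid_two_mul (x : ℝ) :
    sigmoid (2 * x) = Real.exp (x - Real.log (2 * Real.cosh x)) := by
  have hc : 0 < 2 * Real.cosh x := by have := Real.cosh_pos x; positivity
  rw [Real.exp_sub, Real.exp_log hc, sigmoid_def, Real.cosh_eq,
    show -(2 * x) = -x + -x by ring, Real.exp_add, Real.exp_neg]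
  have := Real.exp_pos x
  field_simp

lemma ofReal_exp_cpow (y : ℝ) (u : ℂ) :
    ((Real.exp y : ℝ) : ℂ) ^ u = Complex.exp (y * u) := by
  rw [Complex.cpow_def_of_ne_zero (by exact_mod_cast (Real.exp_pos y).ne'),
    ← Complex.ofReal_log (Real.exp_pos y).le, Real.log_exp]

lemma hasDerivAt_sigmoid_two_mul (x : ℝ) :
    HasDerivAt (fun y => sigmoid (2 * y)) (1 / (2 * Real.cosh x ^ 2)) x := by
  have h := (hasDerivAt_sigmoid (2 * x)).comp x ((hasDerivAt_id x).const_mul 2)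
  refine h.congr_deriv ?_
  have hc : 0 < 2 * Real.cosh x := by have := Real.cosh_pos x; positivity
  rw [← sigmoid_neg, ← mul_neg, sigmoid_two_mul, sigmoid_two_mul, Real.cosh_neg, ← Real.exp_add,
    show x - Real.log (2 * Real.cosh x) + (-x - Real.log (2 * Real.cosh x))
      = -(Real.log (2 * Real.cosh x) + Real.log (2 * Real.cosh x)) by ring,
    Real.exp_neg, Real.exp_add, Real.exp_log hc]
  field_simp

/-- The substitution `t = sigmoid (2 * x)` turns the Beta integral `Β(u, 1 - u)` into an
integral against the hyperbolic secant. -/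
lemma betaIntegral_one_sub_eq_integral_sech (u : ℂ) :
    Complex.betaIntegral u (1 - u) =
      ∫ x : ℝ, Complex.exp ((2 * u - 1) * x) * ((1 / Real.cosh x : ℝ) : ℂ) := by
  have himage : (fun x => sigmoid (2 * x)) '' Set.univ = Set.Ioo 0 1 := by
    rw [Set.image_univ, ← range_sigmoid]
    exact (mul_left_surjective₀ (two_ne_zero (α := ℝ))).range_comp sigmoid
  have hinj : Set.InjOn (fun x : ℝ => sigmoid (2 * x)) Set.univ := fun x _ y _ h => by
    simpa using sigmoid_injective h
  rw [Complex.betaIntegral, intervalIntegral.integral_of_le zero_le_one,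
    integral_Ioc_eq_integral_Ioo, ← himage,
    integral_image_eq_integral_abs_deriv_smul MeasurableSet.univ
      (fun x _ => (hasDerivAt_sigmoid_two_mul x).hasDerivWithinAt) hinj, setIntegral_univ]
  refine integral_congr_ae (.of_forall fun x => ?_)
  have hpos := Real.cosh_pos x
  have hc : 0 < 2 * Real.cosh x := by positivity
  have hne : (Real.cosh x : ℂ) ≠ 0 := by exact_mod_cast hpos.ne'
  have hsub : (1 : ℂ) - (sigmoid (2 * x) : ℝ) = (sigmoid (2 * -x) : ℝ) := by
    rw [mul_neg, sigmoid_neg]; push_cast; ring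
  have hexp : Complex.exp (Real.log (2 * Real.cosh x)) = 2 * (Real.cosh x : ℂ) := by
    rw [← Complex.ofReal_exp, Real.exp_log hc]; push_cast; ring
  dsimp only
  rw [hsub, sigmoid_two_mul, sigmoid_two_mul, Real.cosh_neg, ofReal_exp_cpow, ofReal_exp_cpow,
    ← Complex.exp_add, abs_of_pos (by positivity), Complex.real_smul]
  simp only [Complex.ofReal_sub, Complex.ofReal_neg]
  rw [show ((x : ℂ) - (Real.log (2 * Real.cosh x) : ℝ)) * (u - 1)
      + (-(x : ℂ) - (Real.log (2 * Real.cosh x) : ℝ)) * (1 - u - 1)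
      = (2 * u - 1) * x + (Real.log (2 * Real.cosh x) : ℝ) by ring, Complex.exp_add, hexp]
  simp only [Complex.ofReal_div, Complex.ofReal_mul, Complex.ofReal_pow, Complex.ofReal_one,
    Complex.ofReal_ofNat]
  field_simp

lemma betaIntegral_one_sub {u : ℂ} (h0 : 0 < u.re) (h1 : u.re < 1) :
    Complex.betaIntegral u (1 - u) = π / Complex.sin (π * u) := by
  have h := Complex.Gamma_mul_Gamma_eq_betaIntegral h0 (t := 1 - u) (by simpa using h1)
  rw [← Complex.Gamma_mul_Gamma_one_sub, h]
  simp

theorem fourier_transform_sech :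
    𝓕 (fun x : ℝ => ((1 / Real.cosh x : ℝ) : ℂ))
      = fun ξ : ℝ => (π : ℂ) * ((1 / Real.cosh (π ^ 2 * ξ) : ℝ) : ℂ) := by
  ext ξ
  set u : ℂ := 1 / 2 - (π * ξ : ℝ) * Complex.I with hu
  have hre : u.re = 1 / 2 := by simp [hu]
  have hsin : Complex.sin (π * u) = (Real.cosh (π ^ 2 * ξ) : ℝ) := by
    rw [Complex.ofReal_cosh, ← Complex.cos_mul_I, ← Complex.sin_pi_div_two_sub]
    congr 1
    rw [hu]; push_cast; ring
  have hbeta := betaIntegral_one_sub (u := u) (by rw [hre]; norm_num) (by rw [hre]; norm_num)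
  rw [betaIntegral_one_sub_eq_integral_sech, hsin] at hbeta
  rw [fourier_real_eq_integral_exp_smul, Complex.ofReal_div, Complex.ofReal_one, mul_one_div,
    ← hbeta]
  refine integral_congr_ae (.of_forall fun x => ?_)
  dsimp only
  rw [smul_eq_mul]
  congr 2
  rw [hu]; push_cast; ring
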